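/- arXiv:1903.02502 — 3 statements merged into one kernel-verified Lean document; each statement's English description precedes it below -/
import Mathlib

section
/- Let Ω = [0,1] with Lebesgue measure ℙ, and for n ∈ ℕ let A_n = [1/2 − 1/(n+1), 1/2] and B_n = (1/2, 1/2 + 1/(n+1)], and define g_n = −n·1_{A_n} + n·1_{B_n}. Then ‖g_n‖_{L_1} = 2n/(n+1) < 2 for all n, the sequence (g_n) does not converge to 0 in L_1-norm, yet for every f ∈ L_1([0,1]) one has ‖f − g_n‖_{L_1} − ‖g_n‖_{L_1} → ‖f‖_{L_1} as n → ∞. -/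
open MeasureTheory Filter Topology

/-- Lebesgue measure restricted to `[0,1]`. -/
noncomputable def μ01 : Measure ℝ := volume.restrict (Set.Icc (0 : ℝ) 1)

/-- If `gₙ → 0` almost everywhere, then the internal metric functionals
`f ↦ ‖f - gₙ‖ - ‖gₙ‖` converge pointwise on `L₁` to the norm. -/
theorem tendsto_integral_abs_sub_sub_integral_abs {α : Type*} [MeasurableSpace α]
    {μ : Measure α} {f : α → ℝ} {g : ℕ → α → ℝ} (hf : Integrable f μ)
    (hg : ∀ n, Integrable (g n) μ) (hlim : ∀ᵐ x ∂μ, Tendsto (fun n => g n x) atTop (𝓝 0)) :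
    Tendsto (fun n => (∫ x, |f x - g n x| ∂μ) - ∫ x, |g n x| ∂μ) atTop
      (𝓝 (∫ x, |f x| ∂μ)) := by
  have hsub (n : ℕ) : (∫ x, |f x - g n x| ∂μ) - ∫ x, |g n x| ∂μ
      = ∫ x, (|f x - g n x| - |g n x|) ∂μ :=
    (integral_sub (hf.sub (hg n)).abs (hg n).abs).symm
  simp_rw [hsub]
  refine tendsto_integral_of_dominated_convergence (fun x => |f x|)
    (fun n => ((hf.sub (hg n)).abs.sub (hg n).abs).aestronglyMeasurable) hf.abs
    (fun n => Eventually.of_forall fun x => ?_) ?_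
  · have h := abs_abs_sub_abs_le (f x - g n x) (-g n x)
    rwa [abs_neg, sub_neg_eq_add, sub_add_cancel] at h
  · filter_upwards [hlim] with x hx
    simpa using (hx.const_sub (f x)).abs.sub hx.abs

/-- The absolute value of a function equal to `-c` on `[a - r, a]`, to `c` on `(a, a + r]` and
to `0` elsewhere. -/
theorem abs_indicator_Icc_neg_add_indicator_Ioc {a r c : ℝ} (hr : 0 ≤ r) (hc : 0 ≤ c) (x : ℝ) :
    |(Set.Icc (a - r) a).indicator (fun _ => -c) x + (Set.Ioc a (a + r)).indicator (fun _ => c) x|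
      = (Set.Icc (a - r) (a + r)).indicator (fun _ => c) x := by
  simp only [Set.indicator_apply, Set.mem_Icc, Set.mem_Ioc]
  split_ifs <;> grind

/-- With `Aₙ = [1/2 − 1/(n+1), 1/2]`, `Bₙ = (1/2, 1/2 + 1/(n+1)]` and
`gₙ = −n·1_{Aₙ} + n·1_{Bₙ}`, one has `‖gₙ‖_{L₁} = 2n/(n+1) < 2`, the sequence `(gₙ)` does
not converge to `0` in `L₁`-norm, yet the internal metric functionals `h_{gₙ}` converge
pointwise on `L₁([0,1])` to `h₀ = ‖·‖`. -/
theorem bounded_sequence_converging_to_internal_functional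
    (A B : ℕ → Set ℝ)
    (hA : ∀ n, A n = Set.Icc (1 / 2 - 1 / ((n : ℝ) + 1)) (1 / 2))
    (hB : ∀ n, B n = Set.Ioc (1 / 2) (1 / 2 + 1 / ((n : ℝ) + 1)))
    (g : ℕ → ℝ → ℝ)
    (hg : ∀ n, g n = fun ω => (A n).indicator (fun _ => -(n : ℝ)) ω
        + (B n).indicator (fun _ => (n : ℝ)) ω) :
    (∀ n, ∫ ω, |g n ω| ∂μ01 = 2 * (n : ℝ) / (n + 1)) ∧
    (∀ n, ∫ ω, |g n ω| ∂μ01 < 2) ∧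
    ¬ Tendsto (fun n => ∫ ω, |g n ω| ∂μ01) atTop (𝓝 0) ∧
    ∀ f : ℝ → ℝ, Integrable f μ01 →
      Tendsto (fun n => (∫ ω, |f ω - g n ω| ∂μ01) - ∫ ω, |g n ω| ∂μ01) atTop
        (𝓝 (∫ ω, |f ω| ∂μ01)) := by
  have habs (n : ℕ) (ω : ℝ) : |g n ω| = (Set.Icc (1 / 2 - 1 / ((n : ℝ) + 1))
      (1 / 2 + 1 / ((n : ℝ) + 1))).indicator (fun _ => (n : ℝ)) ω := by
    rw [hg, hA, hB]
    exact abs_indicator_Icc_neg_add_indicator_Ioc (by positivity) n.cast_nonneg ω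
  have hnorm (n : ℕ) : ∫ ω, |g n ω| ∂μ01 = 2 * (n : ℝ) / (n + 1) := by
    rcases Nat.eq_zero_or_pos n with rfl | hn
    · simp [habs]
    · have hn' : (1 : ℝ) ≤ n := by exact_mod_cast hn
      have hr : 1 / ((n : ℝ) + 1) ≤ 1 / 2 := by gcongr; linarith
      have hr0 : 0 ≤ 1 / ((n : ℝ) + 1) := by positivity
      simp_rw [habs]
      rw [integral_indicator_const _ measurableSet_Icc, μ01,
        measureReal_restrict_apply measurableSet_Icc,
        Set.inter_eq_left.2 (Set.Icc_subset_Icc (by linarith) (by linarith)),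
        Real.volume_real_Icc_of_le (by linarith), smul_eq_mul]
      ring
  have : IsFiniteMeasure μ01 := by unfold μ01; infer_instance
  have hint (n : ℕ) : Integrable (g n) μ01 := by
    rw [hg, hA, hB]
    exact ((integrable_const _).indicator measurableSet_Icc).add
      ((integrable_const _).indicator measurableSet_Ioc)
  have hlim : ∀ᵐ ω ∂μ01, Tendsto (fun n => g n ω) atTop (𝓝 0) := by
    have hne : ∀ᵐ ω ∂μ01, ω ≠ 1 / 2 := ae_restrict_of_ae (Measure.ae_ne volume _)
    filter_upwards [hne] with ω hω
    have hpos : 0 < |ω - 1 / 2| := abs_pos.2 (sub_ne_zero.2 hω)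
    refine tendsto_const_nhds.congr' ?_
    filter_upwards [tendsto_one_div_add_atTop_nhds_zero_nat.eventually_lt_const hpos] with n hn
    symm
    rw [← abs_eq_zero, habs, Set.indicator_of_notMem]
    rintro ⟨h₁, h₂⟩
    exact hn.not_ge (abs_le.2 ⟨by linarith, by linarith⟩)
  refine ⟨hnorm, fun n => ?_, fun h => ?_,
    fun f hf => tendsto_integral_abs_sub_sub_integral_abs hf hint hlim⟩
  · rw [hnorm, div_lt_iff₀ (by positivity)]
    linarith
  · obtain ⟨n, hn, hn₁⟩ := ((h.eventually_lt_const one_pos).and (eventually_ge_atTop 1)).exists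
    have hn' : (1 : ℝ) ≤ n := by exact_mod_cast hn₁
    rw [hnorm, div_lt_one (by positivity)] at hn
    linarith
end

section
/- Alspach's map has no fixed points: let Ω = [0,1] with Lebesgue measure, let K = { f ∈ L_1([0,1]) : 0 ≤ f ≤ 2 a.e. and E[f] = 1 }, and define F : K → K by F(f)(ω) = min{2, 2f(2ω)} for 0 ≤ ω ≤ 1/2 and F(f)(ω) = max{0, 2f(2ω−1) − 2} for 1/2 < ω ≤ 1. Then there is no g ∈ K with F(g) = g (as elements of L_1, i.e. almost everywhere). -/
open MeasureTheory Filter Topology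

/-- Membership in Alspach's set `K = {f ∈ L₁([0,1]) : 0 ≤ f ≤ 2 a.e., E[f] = 1}`. -/
def memK (f : ℝ → ℝ) : Prop :=
  Integrable f μ01 ∧ (∀ᵐ ω ∂μ01, 0 ≤ f ω ∧ f ω ≤ 2) ∧ ∫ ω, f ω ∂μ01 = 1

/-- Alspach's map `F(f)(ω) = min{2, 2f(2ω)}` for `ω ≤ 1/2` and
`F(f)(ω) = max{0, 2f(2ω−1) − 2}` for `ω > 1/2`. -/
noncomputable def alspachF (f : ℝ → ℝ) (ω : ℝ) : ℝ :=
  if ω ≤ 1 / 2 then min 2 (2 * f (2 * ω)) else max 0 (2 * f (2 * ω - 1) - 2)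

/-- A bounded function on `[0,1]` that is halved by both inverse branches of the doubling map
vanishes. -/
lemma eq_zero_of_halved_by_doubling_branches {d : ℝ → ℝ} {C : ℝ}
    (hC : ∀ x ∈ Set.Icc (0 : ℝ) 1, |d x| ≤ C)
    (hleft : ∀ x ∈ Set.Icc (0 : ℝ) 1, d (x / 2) = d x / 2)
    (hright : ∀ x ∈ Set.Icc (0 : ℝ) 1, d ((1 + x) / 2) = d x / 2) :
    ∀ x ∈ Set.Icc (0 : ℝ) 1, d x = 0 := by
  have key : ∀ n : ℕ, ∀ x ∈ Set.Icc (0 : ℝ) 1, |d x| ≤ C * (1 / 2) ^ n := by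
    intro n
    induction n with
    | zero => simpa using hC
    | succ n ih =>
      intro x ⟨hx0, hx1⟩
      obtain ⟨y, hy, hdy⟩ : ∃ y ∈ Set.Icc (0 : ℝ) 1, d x = d y / 2 := by
        rcases le_total x (1 / 2) with h | h
        · have hy : 2 * x ∈ Set.Icc (0 : ℝ) 1 := ⟨by linarith, by linarith⟩
          exact ⟨2 * x, hy, by rw [← hleft _ hy]; congr 1; ring⟩
        · have hy : 2 * x - 1 ∈ Set.Icc (0 : ℝ) 1 := ⟨by linarith, by linarith⟩
          exact ⟨2 * x - 1, hy, by rw [← hright _ hy]; congr 1; ring⟩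
      rw [hdy, abs_div, abs_two, pow_succ]
      linarith [ih y hy]
  intro x hx
  have hlim : Tendsto (fun n : ℕ => C * (1 / 2 : ℝ) ^ n) atTop (𝓝 0) := by
    simpa using (tendsto_pow_atTop_nhds_zero_of_lt_one (by norm_num : (0 : ℝ) ≤ 1 / 2)
      (by norm_num)).const_mul C
  exact abs_nonpos_iff.mp (ge_of_tendsto' hlim fun n => key n x hx)

lemma ae_μ01_iff {p : ℝ → Prop} :
    (∀ᵐ ω ∂μ01, p ω) ↔ ∀ᵐ ω, ω ∈ Set.Icc (0 : ℝ) 1 → p ω :=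
  ae_restrict_iff' measurableSet_Icc

lemma integral_μ01 (f : ℝ → ℝ) : ∫ ω, f ω ∂μ01 = ∫ ω in (0 : ℝ)..1, f ω := by
  rw [intervalIntegral.integral_of_le zero_le_one, ← integral_Icc_eq_integral_Ioc, μ01]

lemma integral_left_branch {g : ℝ → ℝ} (hg : alspachF g =ᵐ[μ01] g) (φ : ℝ → ℝ) {x : ℝ}
    (hx : x ∈ Set.Icc (0 : ℝ) 1) :
    ∫ ω in (0 : ℝ)..x / 2, φ (g ω) = (∫ ω in (0 : ℝ)..x, φ (min 2 (2 * g ω))) / 2 := by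
  have hsub := intervalIntegral.integral_comp_mul_left (a := 0) (b := x / 2)
    (fun ω => φ (min 2 (2 * g ω))) (two_ne_zero (α := ℝ))
  rw [mul_zero, mul_div_cancel₀ x two_ne_zero, smul_eq_mul, inv_mul_eq_div] at hsub
  rw [← hsub]
  refine intervalIntegral.integral_congr_ae ?_
  filter_upwards [ae_μ01_iff.mp hg] with ω h hω
  rw [Set.uIoc_of_le (by linarith [hx.1])] at hω
  have hle : ω ≤ 1 / 2 := by linarith [hω.2, hx.2]
  rw [← h ⟨hω.1.le, by linarith⟩, alspachF, if_pos hle]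

lemma integral_right_branch {g : ℝ → ℝ} (hg : alspachF g =ᵐ[μ01] g) (φ : ℝ → ℝ) {x : ℝ}
    (hx : x ∈ Set.Icc (0 : ℝ) 1) :
    ∫ ω in (1 / 2 : ℝ)..(1 + x) / 2, φ (g ω) =
      (∫ ω in (0 : ℝ)..x, φ (max 0 (2 * g ω - 2))) / 2 := by
  have hsub := intervalIntegral.integral_comp_mul_sub (a := 1 / 2) (b := (1 + x) / 2)
    (fun ω => φ (max 0 (2 * g ω - 2))) (two_ne_zero (α := ℝ)) 1
  rw [mul_div_cancel₀ _ two_ne_zero, mul_div_cancel₀ _ two_ne_zero, sub_self, add_sub_cancel_left,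
    smul_eq_mul, inv_mul_eq_div] at hsub
  rw [← hsub]
  refine intervalIntegral.integral_congr_ae ?_
  filter_upwards [ae_μ01_iff.mp hg] with ω h hω
  rw [Set.uIoc_of_le (by linarith [hx.1])] at hω
  have hlt : ¬ ω ≤ 1 / 2 := not_le.mpr hω.1
  rw [← h ⟨by linarith [hω.1], by linarith [hω.2, hx.2]⟩, alspachF, if_neg hlt]

/-- A continuous function of an element of `K` is integrable on subintervals of `[0,1]`. -/
lemma memK.intervalIntegrable_comp {g : ℝ → ℝ} (hg : memK g) {φ : ℝ → ℝ} (hφ : Continuous φ)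
    {a b : ℝ} (ha : a ∈ Set.Icc (0 : ℝ) 1) (hb : b ∈ Set.Icc (0 : ℝ) 1) :
    IntervalIntegrable (fun ω => φ (g ω)) volume a b := by
  obtain ⟨C, hC⟩ := (isCompact_Icc (a := (0 : ℝ)) (b := 2)).exists_bound_of_continuousOn
    hφ.continuousOn
  have : IsFiniteMeasure μ01 := by unfold μ01; infer_instance
  have hint : Integrable (fun ω => φ (g ω)) μ01 :=
    Integrable.of_bound (hφ.comp_aestronglyMeasurable hg.1.aestronglyMeasurable) C
      (hg.2.1.mono fun ω h => hC _ h)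
  have hon : IntegrableOn (fun ω => φ (g ω)) (Set.Icc 0 1) := hint
  exact (hon.mono_set (Set.uIcc_subset_Icc ha hb)).intervalIntegrable

/-- Comparing second moments: `E[g²] = E[F(g)²]` forces a fixed point to take only the values
`0` and `2`. -/
lemma fixedPoint_eq_zero_or_two {g : ℝ → ℝ} (hK : memK g) (hg : alspachF g =ᵐ[μ01] g) :
    ∀ᵐ ω ∂μ01, g ω = 0 ∨ g ω = 2 := by
  have h0 : (0 : ℝ) ∈ Set.Icc (0 : ℝ) 1 := by simp
  have h1 : (1 : ℝ) ∈ Set.Icc (0 : ℝ) 1 := by simp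
  have hhalf : (1 / 2 : ℝ) ∈ Set.Icc (0 : ℝ) 1 := by constructor <;> norm_num
  let ψ : ℝ → ℝ := fun t => ((min 2 (2 * t)) ^ 2 / 2 + (max 0 (2 * t - 2)) ^ 2 / 2) - t ^ 2
  have hψ : ∀ t, (t < 1 ∧ ψ t = t ^ 2) ∨ (1 ≤ t ∧ ψ t = (2 - t) ^ 2) := by
    intro t
    rcases lt_or_ge t 1 with h | h
    · left
      refine ⟨h, ?_⟩
      simp only [ψ]
      rw [min_eq_right (by linarith), max_eq_left (by linarith)]
      ring
    · right
      refine ⟨h, ?_⟩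
      simp only [ψ]
      rw [min_eq_left (by linarith), max_eq_right (by linarith)]
      ring
  have hsplit := intervalIntegral.integral_add_adjacent_intervals
    (hK.intervalIntegrable_comp (continuous_pow 2) h0 hhalf)
    (hK.intervalIntegrable_comp (continuous_pow 2) hhalf h1)
  have hl := integral_left_branch hg (fun t => t ^ 2) h1
  have hr := integral_right_branch hg (fun t => t ^ 2) h1
  rw [show ((1 : ℝ) + 1) / 2 = 1 by norm_num] at hr
  have hzero : ∫ ω in (0 : ℝ)..1, ψ (g ω) = 0 := by
    have hL := hK.intervalIntegrable_comp
      (φ := fun t => (min 2 (2 * t)) ^ 2 / 2) (by fun_prop) h0 h1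
    have hR := hK.intervalIntegrable_comp
      (φ := fun t => (max 0 (2 * t - 2)) ^ 2 / 2) (by fun_prop) h0 h1
    have hS := hK.intervalIntegrable_comp (continuous_pow 2) h0 h1
    simp only [ψ]
    rw [intervalIntegral.integral_sub (hL.add hR) hS, intervalIntegral.integral_add hL hR,
      intervalIntegral.integral_div, intervalIntegral.integral_div, ← hsplit, hl, hr, sub_self]
  have hψint : Integrable (fun ω => ψ (g ω)) μ01 := by
    have h := hK.intervalIntegrable_comp (φ := ψ) (by fun_prop) h0 h1
    rw [intervalIntegrable_iff_integrableOn_Icc_of_le zero_le_one] at h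
    exact h
  have hae := (integral_eq_zero_iff_of_nonneg
    (fun ω => by rcases hψ (g ω) with ⟨_, h⟩ | ⟨_, h⟩ <;> simp only [Pi.zero_apply, h] <;> positivity)
    hψint).mp (by rw [integral_μ01, hzero])
  filter_upwards [hae] with ω h
  simp only [Pi.zero_apply] at h
  rcases hψ (g ω) with ⟨_, h'⟩ | ⟨_, h'⟩
  · exact Or.inl (pow_eq_zero_iff two_ne_zero |>.mp (h' ▸ h))
  · exact Or.inr (by linarith [pow_eq_zero_iff two_ne_zero |>.mp (h' ▸ h)])

/-- A fixed point has the same mean on every interval `[0, x]`. -/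
lemma fixedPoint_integral_eq {g : ℝ → ℝ} (hK : memK g) (hg : alspachF g =ᵐ[μ01] g) :
    ∀ x ∈ Set.Icc (0 : ℝ) 1, ∫ ω in (0 : ℝ)..x, g ω = x := by
  have h0 : (0 : ℝ) ∈ Set.Icc (0 : ℝ) 1 := by simp
  have h1 : (1 : ℝ) ∈ Set.Icc (0 : ℝ) 1 := by simp
  have hhalf : (1 / 2 : ℝ) ∈ Set.Icc (0 : ℝ) 1 := by constructor <;> norm_num
  have hvalues := ae_μ01_iff.mp (fixedPoint_eq_zero_or_two hK hg)
  have htotal : ∫ ω in (0 : ℝ)..1, g ω = 1 := by rw [← integral_μ01, hK.2.2]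
  have hleft : ∀ x ∈ Set.Icc (0 : ℝ) 1,
      ∫ ω in (0 : ℝ)..x / 2, g ω = (∫ ω in (0 : ℝ)..x, g ω) / 2 := by
    intro x hx
    rw [integral_left_branch hg (fun t => t) hx]
    congr 1
    refine intervalIntegral.integral_congr_ae ?_
    filter_upwards [hvalues] with ω h hω
    rw [Set.uIoc_of_le hx.1] at hω
    rcases h ⟨hω.1.le, hω.2.trans hx.2⟩ with h | h <;> rw [h] <;> norm_num
  have hright : ∀ x ∈ Set.Icc (0 : ℝ) 1,
      ∫ ω in (1 / 2 : ℝ)..(1 + x) / 2, g ω = (∫ ω in (0 : ℝ)..x, g ω) / 2 := by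
    intro x hx
    rw [integral_right_branch hg (fun t => t) hx]
    congr 1
    refine intervalIntegral.integral_congr_ae ?_
    filter_upwards [hvalues] with ω h hω
    rw [Set.uIoc_of_le hx.1] at hω
    rcases h ⟨hω.1.le, hω.2.trans hx.2⟩ with h | h <;> rw [h] <;> norm_num
  intro x hx
  refine sub_eq_zero.mp (eq_zero_of_halved_by_doubling_branches
    (d := fun x => (∫ ω in (0 : ℝ)..x, g ω) - x) (C := 3) ?_ ?_ ?_ x hx)
  · intro x hx
    have hbound : ‖∫ ω in (0 : ℝ)..x, g ω‖ ≤ 2 * |x - 0| := by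
      refine intervalIntegral.norm_integral_le_of_norm_le_const_ae ?_
      filter_upwards [hvalues] with ω h hω
      rw [Set.uIoc_of_le hx.1] at hω
      rcases h ⟨hω.1.le, hω.2.trans hx.2⟩ with h | h <;> rw [h] <;> norm_num
    rw [sub_zero, abs_of_nonneg hx.1, Real.norm_eq_abs, abs_le] at hbound
    rw [abs_le]
    constructor <;> linarith [hbound.1, hbound.2, hx.1, hx.2]
  · intro x hx
    simp only [hleft x hx]
    ring
  · intro x hx
    have hmem : (1 + x) / 2 ∈ Set.Icc (0 : ℝ) 1 :=
      ⟨by linarith [hx.1], by linarith [hx.2]⟩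
    have hsplit := intervalIntegral.integral_add_adjacent_intervals
      (hK.intervalIntegrable_comp continuous_id h0 hhalf)
      (hK.intervalIntegrable_comp continuous_id hhalf hmem)
    simp only [id] at hsplit
    simp only [← hsplit, hright x hx, hleft 1 h1, htotal]
    ring

/-- Alspach's map has no fixed points in `K` (as elements of `L₁`, i.e. up to almost
everywhere equality). -/
theorem alspachF_has_no_fixed_point :
    ¬ ∃ g : ℝ → ℝ, memK g ∧ alspachF g =ᵐ[μ01] g := by
  rintro ⟨g, hK, hg⟩
  have hint : IntervalIntegrable g volume 0 1 :=
    hK.intervalIntegrable_comp continuous_id (by simp) (by simp)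
  have hfalse : ∀ᵐ ω : ℝ, ω ∉ Set.Ioo (0 : ℝ) 1 := by
    filter_upwards [hint.ae_hasDerivAt_integral, ae_μ01_iff.mp (fixedPoint_eq_zero_or_two hK hg)]
      with ω hderiv hvalue hω
    have hIcc : ω ∈ Set.Icc (0 : ℝ) 1 := Set.Ioo_subset_Icc_self hω
    have hd := hderiv (by rwa [Set.uIcc_of_le zero_le_one]) 0 (by simp)
    have heq : (fun x => ∫ t in (0 : ℝ)..x, g t) =ᶠ[𝓝 ω] id := by
      filter_upwards [Ioo_mem_nhds hω.1 hω.2] with x hx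
      exact fixedPoint_integral_eq hK hg x (Set.Ioo_subset_Icc_self hx)
    have hone : g ω = 1 := hd.unique ((hasDerivAt_id ω).congr_of_eventuallyEq heq)
    rcases hvalue hIcc with h | h <;> rw [h] at hone <;> norm_num at hone
  have hnull : volume (Set.Ioo (0 : ℝ) 1) = 0 := measure_eq_zero_iff_ae_notMem.mpr hfalse
  simp at hnull
end

section
/- With g_n = 1 + r_n, where r_n(ω) = sgn(sin(2ⁿ π ω)) is the n-th Rademacher function on [0,1]: for every f ∈ L_1([0,1]), ‖f − g_n‖_{L_1} − ‖g_n‖_{L_1} → E[ (1/2)|f| + (1/2)(|f−2| − 2) ] as n → ∞; moreover this limit functional h(f) = E[ (1/2)|f| + (1/2)(|f−2| − 2) ] satisfies h(f) = 0 for every f in K = { f ∈ L_1([0,1]) : 0 ≤ f ≤ 2 a.e. and E[f] = 1 }. -/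
open MeasureTheory Filter Topology Real

/-- Translation is continuous in `L¹(ℝ)`. -/
theorem tendsto_integral_norm_translate_sub {ψ : ℝ → ℝ} (hψ : Integrable ψ) :
    Tendsto (fun c : ℝ => ∫ x, ‖ψ (c + x) - ψ x‖) (𝓝 0) (𝓝 0) := by
  have hψ' : MemLp ψ 1 := memLp_one_iff_integrable.2 hψ
  let F : Lp ℝ 1 (volume : Measure ℝ) := hψ'.toLp ψ
  have : Fact ((1 : ENNReal) ≠ ⊤) := ⟨ENNReal.one_ne_top⟩
  have hcont : Continuous fun c : ℝ => dist (DomAddAct.mk c +ᵥ F) F := by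
    have h1 : Continuous fun c : ℝ => DomAddAct.mk c +ᵥ F :=
      (DomAddAct.continuous_mk).vadd continuous_const
    exact h1.dist continuous_const
  have hdist : ∀ c : ℝ, dist (DomAddAct.mk c +ᵥ F) F = ∫ x, ‖ψ (c + x) - ψ x‖ := by
    intro c
    rw [L1.dist_eq_integral_dist]
    refine integral_congr_ae ?_
    have hc : DomAddAct.mk c +ᵥ F =ᵐ[volume] fun x => ψ (c + x) := by
      rw [DomAddAct.mk_vadd_toLp]
      exact MemLp.coeFn_toLp _
    filter_upwards [hc, hψ'.coeFn_toLp] with x h1 h2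
    rw [h1, h2, dist_eq_norm]
  have h0 := hcont.tendsto 0
  simp only [hdist] at h0
  simpa using h0

/-- A Riemann–Lebesgue lemma for bounded functions that are antiperiodic with antiperiods tending
to zero. -/
theorem tendsto_integral_mul_of_antiperiodic {s : ℕ → ℝ → ℝ} {c : ℕ → ℝ}
    (hs : ∀ n, Measurable (s n)) (hbound : ∀ n x, ‖s n x‖ ≤ 1)
    (hanti : ∀ n, Function.Antiperiodic (s n) (c n)) (hc : Tendsto c atTop (𝓝 0))
    {ψ : ℝ → ℝ} (hψ : Integrable ψ) :
    Tendsto (fun n => ∫ x, s n x * ψ x) atTop (𝓝 0) := by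
  refine squeeze_zero_norm (fun n => ?_) ((tendsto_integral_norm_translate_sub hψ).comp hc)
  have hψc : Integrable fun x => ψ (c n + x) := hψ.comp_add_left (c n)
  have hmul : ∀ {φ : ℝ → ℝ}, Integrable φ → Integrable fun x => s n x * φ x := fun hφ =>
    hφ.bdd_mul (hs n).aestronglyMeasurable (Eventually.of_forall (hbound n))
  have hshift : ∫ x, s n x * ψ x = -∫ x, s n x * ψ (c n + x) := by
    rw [← integral_add_left_eq_self (fun x => s n x * ψ x) (c n), ← integral_neg]
    refine integral_congr_ae (Eventually.of_forall fun x => ?_)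
    simp only
    rw [add_comm (c n) x, hanti n x, neg_mul]
  have htwo : 2 * ∫ x, s n x * ψ x = -∫ x, s n x * (ψ (c n + x) - ψ x) := by
    simp only [mul_sub]
    rw [integral_sub (hmul hψc) (hmul hψ)]
    linarith
  have hle : ‖∫ x, s n x * (ψ (c n + x) - ψ x)‖ ≤ ∫ x, ‖ψ (c n + x) - ψ x‖ := by
    refine norm_integral_le_of_norm_le (hψc.sub hψ).norm (Eventually.of_forall fun x => ?_)
    rw [norm_mul]
    exact mul_le_of_le_one_left (norm_nonneg _) (hbound n x)
  have hnorm : 2 * ‖∫ x, s n x * ψ x‖ = ‖∫ x, s n x * (ψ (c n + x) - ψ x)‖ := by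
    rw [← norm_neg (∫ x, s n x * (ψ (c n + x) - ψ x)), ← htwo, norm_mul]
    norm_num
  have := norm_nonneg (∫ x, s n x * ψ x)
  simp only [Function.comp_apply]
  linarith

/-- The `n`-th Rademacher function, extended periodically to `ℝ`. -/
noncomputable def rademacher (n : ℕ) (ω : ℝ) : ℝ := Real.sign (Real.sin (2 ^ n * π * ω))

theorem measurable_rademacher (n : ℕ) : Measurable (rademacher n) := by
  have hsign : Measurable Real.sign :=
    Measurable.ite measurableSet_Iio measurable_const
      (Measurable.ite measurableSet_Ioi measurable_const measurable_const)
  exact hsign.comp (by fun_prop)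

theorem norm_rademacher_le_one (n : ℕ) (ω : ℝ) : ‖rademacher n ω‖ ≤ 1 := by
  rcases Real.sign_apply_eq (Real.sin (2 ^ n * π * ω)) with h | h | h <;>
    simp [rademacher, h]

theorem antiperiodic_rademacher (n : ℕ) :
    Function.Antiperiodic (rademacher n) ((1 / 2 : ℝ) ^ n) := by
  intro ω
  have h : (2 : ℝ) ^ n * π * (ω + (1 / 2) ^ n) = 2 ^ n * π * ω + π := by
    rw [one_div_pow]
    field_simp
  rw [rademacher, h, Real.sin_add_pi, Real.sign_neg, rademacher]

theorem ae_rademacher_eq (n : ℕ) : ∀ᵐ ω : ℝ, rademacher n ω = -1 ∨ rademacher n ω = 1 := by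
  have hcount : (Set.range fun k : ℤ => (k : ℝ) / 2 ^ n).Countable := Set.countable_range _
  filter_upwards [hcount.ae_notMem volume] with ω hω
  refine Real.sign_apply_eq_of_ne_zero _ fun h => hω ?_
  obtain ⟨k, hk⟩ := Real.sin_eq_zero_iff.1 h
  refine ⟨k, ?_⟩
  have hk' : (k : ℝ) = 2 ^ n * ω := mul_right_cancel₀ Real.pi_ne_zero (by linarith)
  simp only [hk']
  field_simp

theorem tendsto_integral_rademacher_mul {φ : ℝ → ℝ} (hφ : Integrable φ μ01) :
    Tendsto (fun n => ∫ ω, rademacher n ω * φ ω ∂μ01) atTop (𝓝 0) := by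
  have hψ : Integrable ((Set.Icc (0 : ℝ) 1).indicator φ) :=
    (integrable_indicator_iff measurableSet_Icc).2 hφ
  refine (tendsto_integral_mul_of_antiperiodic measurable_rademacher norm_rademacher_le_one
    antiperiodic_rademacher
    (tendsto_pow_atTop_nhds_zero_of_lt_one (by norm_num) (by norm_num)) hψ).congr fun n => ?_
  rw [μ01, ← integral_indicator measurableSet_Icc]
  simp only [Set.indicator_mul_right]

theorem abs_sub_one_add_sub_abs_one_add {y r : ℝ} (hr : r = -1 ∨ r = 1) :
    |y - (1 + r)| - |1 + r|
      = ((1 / 2) * |y| + (1 / 2) * (|y - 2| - 2)) + r * ((1 / 2) * (|y - 2| - |y|) - 1) := by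
  rcases hr with rfl | rfl <;> norm_num <;> ring

instance isProbabilityMeasure_μ01 : IsProbabilityMeasure μ01 := ⟨by simp [μ01]⟩

/-- For `gₙ = 1 + rₙ` with `rₙ` the `n`-th Rademacher function, the internal metric
functionals `h_{gₙ}` converge pointwise on `L₁([0,1])` to
`h(f) = E[(1/2)|f| + (1/2)(|f−2| − 2)]`, and this limit functional vanishes on `K`. -/
theorem shifted_rademacher_limit_functional_vanishes_on_K
    (g : ℕ → ℝ → ℝ)
    (hg : ∀ n, g n = fun ω => 1 + Real.sign (Real.sin (2 ^ n * π * ω))) :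
    (∀ f : ℝ → ℝ, Integrable f μ01 →
      Tendsto (fun n => (∫ ω, |f ω - g n ω| ∂μ01) - ∫ ω, |g n ω| ∂μ01) atTop
        (𝓝 (∫ ω, ((1 / 2) * |f ω| + (1 / 2) * (|f ω - 2| - 2)) ∂μ01))) ∧
    ∀ f : ℝ → ℝ, memK f →
      ∫ ω, ((1 / 2) * |f ω| + (1 / 2) * (|f ω - 2| - 2)) ∂μ01 = 0 := by
  have hg' : ∀ n, g n = fun ω => 1 + rademacher n ω := hg
  refine ⟨fun f hf => ?_, fun f ⟨_, hbd, hint⟩ => ?_⟩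
  · have hf2 : Integrable (fun ω => |f ω - 2|) μ01 := (hf.sub (integrable_const 2)).abs
    have hlim : Integrable (fun ω => (1 / 2) * |f ω| + (1 / 2) * (|f ω - 2| - 2)) μ01 :=
      (hf.abs.const_mul _).add ((hf2.sub (integrable_const 2)).const_mul _)
    have hφ : Integrable (fun ω => (1 / 2) * (|f ω - 2| - |f ω|) - 1) μ01 :=
      ((hf2.sub hf.abs).const_mul _).sub (integrable_const 1)
    have hconv := (tendsto_integral_rademacher_mul hφ).const_add
      (∫ ω, ((1 / 2) * |f ω| + (1 / 2) * (|f ω - 2| - 2)) ∂μ01)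
    rw [add_zero] at hconv
    refine hconv.congr fun n => ?_
    have hr : Integrable (rademacher n) μ01 :=
      Integrable.of_bound (measurable_rademacher n).aestronglyMeasurable 1
        (Eventually.of_forall (norm_rademacher_le_one n))
    have hgn : Integrable (g n) μ01 := by
      rw [hg' n]
      exact (integrable_const 1).add hr
    have hfg : Integrable (fun ω => |f ω - g n ω|) μ01 := (hf.sub hgn).abs
    rw [← integral_sub hfg hgn.abs, ← integral_add hlim
      (hφ.bdd_mul (measurable_rademacher n).aestronglyMeasurable
        (Eventually.of_forall (norm_rademacher_le_one n)))]
    refine integral_congr_ae ?_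
    filter_upwards [ae_restrict_of_ae (ae_rademacher_eq n)] with ω hω
    simp only [hg']
    exact (abs_sub_one_add_sub_abs_one_add hω).symm
  · refine integral_eq_zero_of_ae ?_
    filter_upwards [hbd] with ω ⟨h0, h2⟩
    rw [abs_of_nonneg h0, abs_of_nonpos (by linarith)]
    simp only [Pi.zero_apply]
    ring
end
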